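/- Let n ≥ 1, let p_i ∈ (0,1] for i = 1,…,n, let r_i ≥ 0, θ_i ≥ 0, and let η ≥ 0. Let σ be a permutation of {1,…,n}, fix 1 ≤ k ≤ n−1, and let σ' be the permutation obtained from σ by exchanging the entries in positions k and k+1 (σ'(k) = σ(k+1), σ'(k+1) = σ(k), σ'(i) = σ(i) otherwise). Then J(σ) − J(σ') = (∏_{j=1}^{k-1} (1 − p_{σ(j)})) · p_{σ(k)} p_{σ(k+1)} · [ (r_{σ(k)} − η θ_{σ(k)}/p_{σ(k)}) − (r_{σ(k+1)} − η θ_{σ(k+1)}/p_{σ(k+1)}) ]. -/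

import Mathlib

open Finset

/-- `cSched p σ i` is the probability `c_{i}` that the first success occurs exactly at the
(0-based) position `i` of the scheduling sequence `σ`:
`c_i(σ) = p_{σ(i)} ∏_{j<i} (1 - p_{σ(j)})`. -/
noncomputable def cSched {n : ℕ} (p : Fin n → ℝ) (σ : Equiv.Perm (Fin n)) (i : Fin n) : ℝ :=
  p (σ i) * ∏ j ∈ Finset.Iio i, (1 - p (σ j))

/-- `cLastSched p σ = c_{n+1}(σ) = ∏_{j=1}^n (1 - p_{σ(j)})`, the probability of no success. -/
noncomputable def cLastSched {n : ℕ} (p : Fin n → ℝ) (σ : Equiv.Perm (Fin n)) : ℝ :=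
  ∏ j, (1 - p (σ j))

/-- Eventual expected reward `R̄(σ) = ∑_i r_{σ(i)} c_i(σ)`. -/
noncomputable def Rbar {n : ℕ} (r p : Fin n → ℝ) (σ : Equiv.Perm (Fin n)) : ℝ :=
  ∑ i, r (σ i) * cSched p σ i

/-- Expected end time
`T̄(σ) = c_{n+1}(σ) ∑_k θ_{σ(k)} + ∑_i c_i(σ) ∑_{k ≤ i} θ_{σ(k)}`. -/
noncomputable def Tbar {n : ℕ} (p θ : Fin n → ℝ) (σ : Equiv.Perm (Fin n)) : ℝ :=
  cLastSched p σ * (∑ k, θ (σ k)) + ∑ i, cSched p σ i * ∑ k ∈ Finset.Iic i, θ (σ k)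

/-- Tradeoff objective `J(σ) = R̄(σ) - η T̄(σ)`. -/
noncomputable def Jobj {n : ℕ} (r p θ : Fin n → ℝ) (η : ℝ) (σ : Equiv.Perm (Fin n)) : ℝ :=
  Rbar r p σ - η * Tbar p θ σ

/-- `z_i(σ) = r_{σ(i)} - η ∑_{k ≤ i} θ_{σ(k)}` (0-based position `i`). -/
noncomputable def zSeq {n : ℕ} (r θ : Fin n → ℝ) (η : ℝ) (σ : Equiv.Perm (Fin n))
    (i : Fin n) : ℝ :=
  r (σ i) - η * ∑ k ∈ Finset.Iic i, θ (σ k)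

/-- Residual value: `Vres … σ k` is the paper's
`V_k(σ) = ∑_{i=k+1}^n z_i(σ) p_{σ(i)} ∏_{j=k+1}^{i-1} (1 - p_{σ(j)})`,
where the paper's 1-based position `k+1` corresponds to the 0-based index `k : Fin n`. -/
noncomputable def Vres {n : ℕ} (r p θ : Fin n → ℝ) (η : ℝ) (σ : Equiv.Perm (Fin n))
    (k : Fin n) : ℝ :=
  ∑ i ∈ Finset.Ici k, zSeq r θ η σ i * p (σ i) * ∏ j ∈ Finset.Ico k i, (1 - p (σ j))

/-- Summation by parts: the expected end time is the sum of the response times weighted by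
the probabilities of reaching the corresponding positions. -/
lemma prod_mul_sum_add_sum_stopping {n : ℕ} (q t : Fin n → ℝ) :
    (∏ j, (1 - q j)) * ∑ k, t k +
        ∑ i, (q i * ∏ j ∈ Finset.Iio i, (1 - q j)) * ∑ k ∈ Finset.Iic i, t k =
      ∑ i, t i * ∏ j ∈ Finset.Iio i, (1 - q j) := by
  induction n with
  | zero => simp
  | succ n ih =>
    have h := ih (fun i => q i.castSucc) (fun i => t i.castSucc)
    have hlast : Finset.Iic (Fin.last n) = Finset.univ := by
      ext x; simp [Fin.le_last]
    have hcast (i : Fin n) :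
        Finset.Iic i.castSucc = (Finset.Iic i).map Fin.castSuccEmb :=
      (Fin.map_castSuccEmb_Iic i).symm
    simp only [Fin.sum_univ_castSucc, Fin.prod_univ_castSucc, Fin.Iio_castSucc,
      hcast, Fin.Iio_last_eq_map, hlast, Finset.prod_map, Finset.sum_map,
      Fin.coe_castSuccEmb]
    rw [← h]
    ring

lemma Tbar_eq_sum {n : ℕ} (p θ : Fin n → ℝ) (σ : Equiv.Perm (Fin n)) :
    Tbar p θ σ = ∑ i, θ (σ i) * ∏ j ∈ Finset.Iio i, (1 - p (σ j)) :=
  prod_mul_sum_add_sum_stopping (fun i => p (σ i)) (fun i => θ (σ i))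

lemma Jobj_eq_sum {n : ℕ} (r p θ : Fin n → ℝ) (η : ℝ) (σ : Equiv.Perm (Fin n)) :
    Jobj r p θ η σ =
      ∑ i, (r (σ i) * p (σ i) - η * θ (σ i)) * ∏ j ∈ Finset.Iio i, (1 - p (σ j)) := by
  rw [Jobj, Tbar_eq_sum, Rbar, Finset.mul_sum, ← Finset.sum_sub_distrib]
  refine Finset.sum_congr rfl fun i _ => ?_
  rw [cSched]
  ring

/-- Exchanging adjacent positions does not change the product over an initial segment that
contains both or neither of them. -/
lemma prod_Iio_swap_succ {M : Type*} [CommMonoid M] {n : ℕ} (f : Fin n → M) (k : Fin n)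
    (hk : (k : ℕ) + 1 < n) {i : Fin n} (hi : i ≠ ⟨(k : ℕ) + 1, hk⟩) :
    ∏ j ∈ Finset.Iio i, f (Equiv.swap k ⟨(k : ℕ) + 1, hk⟩ j) = ∏ j ∈ Finset.Iio i, f j := by
  refine Finset.prod_equiv (Equiv.swap k ⟨(k : ℕ) + 1, hk⟩) (fun j => ?_) fun _ _ => rfl
  rw [Finset.mem_Iio, Finset.mem_Iio, Equiv.swap_apply_def]
  split_ifs <;> simp_all only [Fin.lt_def, Fin.ext_iff, ne_eq] <;> omega

lemma prod_Iio_succ {M : Type*} [CommMonoid M] {n : ℕ} (f : Fin n → M) (k : Fin n)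
    (hk : (k : ℕ) + 1 < n) :
    ∏ j ∈ Finset.Iio (⟨(k : ℕ) + 1, hk⟩ : Fin n), f j = f k * ∏ j ∈ Finset.Iio k, f j := by
  have h : Finset.Iio (⟨(k : ℕ) + 1, hk⟩ : Fin n) = insert k (Finset.Iio k) := by
    ext j
    simp only [Finset.mem_Iio, Finset.mem_insert, Fin.lt_def, Fin.ext_iff]
    omega
  rw [h, Finset.prod_insert (by simp)]

/-- The exchange formula for the full objective: swapping the entries in
(0-based) positions `k` and `k+1` of `σ` changes `J` by
`(∏_{j<k} (1-p_{σ(j)})) p_{σ(k)} p_{σ(k+1)} [(r_{σ(k)} - η θ_{σ(k)}/p_{σ(k)}) -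
(r_{σ(k+1)} - η θ_{σ(k+1)}/p_{σ(k+1)})]`. -/
theorem exchange_formula_J {n : ℕ} (hn : 1 ≤ n) (r p θ : Fin n → ℝ)
    (hp : ∀ i, p i ∈ Set.Ioc (0 : ℝ) 1) (hr : ∀ i, 0 ≤ r i) (hθ : ∀ i, 0 ≤ θ i)
    (η : ℝ) (hη : 0 ≤ η) (σ : Equiv.Perm (Fin n))
    (k : Fin n) (hk : (k : ℕ) + 1 < n) :
    Jobj r p θ η σ - Jobj r p θ η (σ * Equiv.swap k ⟨(k : ℕ) + 1, hk⟩) =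
      (∏ j ∈ Finset.Iio k, (1 - p (σ j))) *
        (p (σ k) * p (σ ⟨(k : ℕ) + 1, hk⟩)) *
        ((r (σ k) - η * θ (σ k) / p (σ k)) -
          (r (σ ⟨(k : ℕ) + 1, hk⟩) -
            η * θ (σ ⟨(k : ℕ) + 1, hk⟩) / p (σ ⟨(k : ℕ) + 1, hk⟩))) := by
  have hkm : k ≠ ⟨(k : ℕ) + 1, hk⟩ := by simp [Fin.ext_iff]
  rw [Jobj_eq_sum, Jobj_eq_sum, ← Finset.sum_sub_distrib,
    Finset.sum_eq_add k ⟨(k : ℕ) + 1, hk⟩ hkm]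
  · have h1 := (hp (σ k)).1.ne'
    have h2 := (hp (σ ⟨(k : ℕ) + 1, hk⟩)).1.ne'
    have hprod := prod_Iio_swap_succ (fun j => 1 - p (σ j)) k hk hkm
    simp only [prod_Iio_succ _ k hk, Equiv.Perm.mul_apply, Equiv.swap_apply_left,
      Equiv.swap_apply_right, hprod]
    field_simp
    ring
  · rintro i - ⟨hik, him⟩
    simp only [Equiv.Perm.mul_apply, Equiv.swap_apply_of_ne_of_ne hik him,
      prod_Iio_swap_succ (fun j => 1 - p (σ j)) k hk him, sub_self]
  · simp
  · simp
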